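/- Orthogonality of special Hermite functions under twisted convolution: Φ_{μ,ν} × Φ_{α,β} = (2π)^{n/2} Φ_{μ,β} if ν = α, and Φ_{μ,ν} × Φ_{α,β} = 0 otherwise, where Φ_{μ,ν}(z) = (2π)^{-n/2} ∫_{ℝⁿ} e^{ix·ξ} Φ_μ(ξ + y/2) Φ_ν(ξ − y/2) dξ for z = x + iy. -/

import Mathlib

open MeasureTheory Complex Real

/-- The `k`-th (physicists') Hermite polynomial via the Rodrigues formula. -/
noncomputable def hermitePoly (k : ℕ) (x : ℝ) : ℝ :=
  (-1 : ℝ) ^ k * Real.exp (x ^ 2) * iteratedDeriv k (fun t => Real.exp (-t ^ 2)) x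

/-- The normalized Hermite function `h_k(x) = (2^k √π k!)^{-1/2} H_k(x) e^{-x²/2}`. -/
noncomputable def hermiteFun (k : ℕ) (x : ℝ) : ℝ :=
  ((2 : ℝ) ^ k * Real.sqrt Real.pi * (k.factorial : ℝ)) ^ (-(1 / 2 : ℝ)) *
    hermitePoly k x * Real.exp (-x ^ 2 / 2)

/-- The special Hermite function `Φ_{μ,ν}`, the Fourier–Wigner transform of the
`n`-dimensional Hermite functions `Φ_μ, Φ_ν`:
`Φ_{μ,ν}(z) = (2π)^{-n/2} ∫_{ℝⁿ} e^{ix·ξ} Φ_μ(ξ + y/2) Φ_ν(ξ − y/2) dξ`,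
for `z = x + iy`. -/
noncomputable def specialHermite (n : ℕ) (μ ν : Fin n → ℕ) (z : Fin n → ℂ) : ℂ :=
  (((2 * Real.pi) ^ (-(n : ℝ) / 2) : ℝ) : ℂ) *
    ∫ ξ : Fin n → ℝ,
      Complex.exp (Complex.I * ((∑ j, (z j).re * ξ j : ℝ) : ℂ)) *
        ((∏ j, hermiteFun (μ j) (ξ j + (z j).im / 2) : ℝ) : ℂ) *
        ((∏ j, hermiteFun (ν j) (ξ j - (z j).im / 2) : ℝ) : ℂ)

/-- The twisted convolution on `ℂⁿ`. -/
noncomputable def twistedConv {n : ℕ} (f g : (Fin n → ℂ) → ℂ) (z : Fin n → ℂ) : ℂ :=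
  ∫ w : Fin n → ℂ, f (z - w) * g w *
    Complex.exp (Complex.I / 2 * (((∑ j, z j * (starRingEnd ℂ) (w j)).im : ℝ) : ℂ))


open Polynomial in
lemma integrable_poly_gauss (p : ℝ[X]) {b : ℝ} (hb : 0 < b) :
    Integrable (fun x : ℝ => p.eval x * Real.exp (-b * x ^ 2)) := by
  induction p using Polynomial.induction_on' with
  | add p q hp hq =>
    refine (hp.add hq).congr (Filter.Eventually.of_forall fun x => ?_)
    simp [add_mul]
  | monomial n a =>
    have h := (integrable_rpow_mul_exp_neg_mul_sq hb (s := (n : ℝ))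
      (by have := n.cast_nonneg (α := ℝ); linarith)).const_mul a
    refine h.congr (Filter.Eventually.of_forall fun x => ?_)
    simp [mul_assoc]

open Polynomial in
lemma integrable_cpoly_gauss (p : ℂ[X]) {b : ℝ} (hb : 0 < b) :
    Integrable (fun x : ℝ => p.eval (x : ℂ) * ((Real.exp (-b * x ^ 2) : ℝ) : ℂ)) := by
  induction p using Polynomial.induction_on' with
  | add p q hp hq =>
    refine (hp.add hq).congr (Filter.Eventually.of_forall fun x => ?_)
    simp [add_mul]
  | monomial n a =>
    have h := ((integrable_poly_gauss (X ^ n) hb).ofReal (𝕜 := ℂ)).const_mul a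
    refine h.congr (Filter.Eventually.of_forall fun x => ?_)
    simp [mul_assoc]

/-- Fourier transform of polynomial times gaussian. -/
noncomputable def gaussFT (r : Polynomial ℝ) (x : ℝ) : ℂ :=
  ∫ ξ : ℝ, cexp (I * ((x * ξ : ℝ) : ℂ)) * ((r.eval ξ * Real.exp (-1 * ξ ^ 2) : ℝ) : ℂ)

lemma norm_phase (t : ℝ) : ‖cexp (I * (t : ℂ))‖ = 1 := by
  rw [mul_comm]; exact Complex.norm_exp_ofReal_mul_I t

lemma integrable_phase_mul {α : Type*} [TopologicalSpace α] [MeasurableSpace α]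
    [OpensMeasurableSpace α]
    {m : Measure α} {f : α → ℂ} (hf : Integrable f m) (t : α → ℝ) (ht : Continuous t) :
    Integrable (fun a => cexp (I * (t a : ℂ)) * f a) m := by
  refine hf.bdd_mul (c := 1) ?_ (Filter.Eventually.of_forall fun a => (norm_phase _).le)
  exact (by fun_prop : Continuous fun a => cexp (I * (t a : ℂ))).aestronglyMeasurable

lemma gaussFT_integrable (r : Polynomial ℝ) (x : ℝ) :
    Integrable fun ξ : ℝ => cexp (I * ((x * ξ : ℝ) : ℂ)) *
      ((r.eval ξ * Real.exp (-1 * ξ ^ 2) : ℝ) : ℂ) :=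
  integrable_phase_mul ((integrable_poly_gauss r one_pos).ofReal) (fun ξ => x * ξ) (by fun_prop)

lemma gaussFT_add (r s : Polynomial ℝ) (x : ℝ) :
    gaussFT (r + s) x = gaussFT r x + gaussFT s x := by
  unfold gaussFT
  rw [← integral_add (gaussFT_integrable r x) (gaussFT_integrable s x)]
  congr 1; ext ξ; push_cast [Polynomial.eval_add]; ring

lemma gaussFT_smul (a : ℝ) (s : Polynomial ℝ) (x : ℝ) :
    gaussFT (Polynomial.C a * s) x = a * gaussFT s x := by
  unfold gaussFT
  rw [← integral_const_mul]
  congr 1; ext ξ; push_cast [Polynomial.eval_mul, Polynomial.eval_C]; ring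

open Polynomial in
lemma gaussFT_X_mul (r : ℝ[X]) (x : ℝ) :
    gaussFT (X * r) x = (I * x * gaussFT r x + gaussFT (derivative r) x) / 2 := by
  have key := integral_eq_zero_of_hasDerivAt_of_integrable
    (f := fun ξ : ℝ => cexp (I * ((x * ξ : ℝ) : ℂ)) *
      ((r.eval ξ * Real.exp (-1 * ξ ^ 2) : ℝ) : ℂ))
    (f' := fun ξ : ℝ => (I * x) * (cexp (I * ((x * ξ : ℝ) : ℂ)) *
      ((r.eval ξ * Real.exp (-1 * ξ ^ 2) : ℝ) : ℂ)) + (cexp (I * ((x * ξ : ℝ) : ℂ)) *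
      (((derivative r).eval ξ * Real.exp (-1 * ξ ^ 2) : ℝ) : ℂ)) - 2 * (cexp (I * ((x * ξ : ℝ) : ℂ)) *
      (((X * r).eval ξ * Real.exp (-1 * ξ ^ 2) : ℝ) : ℂ)))
    ?_ ?_ (gaussFT_integrable r x)
  · rw [integral_sub (((gaussFT_integrable r x).const_mul _).fun_add (gaussFT_integrable _ x))
      ((gaussFT_integrable _ x).const_mul _), integral_add ((gaussFT_integrable r x).const_mul _)
      (gaussFT_integrable _ x), integral_const_mul, integral_const_mul] at key
    unfold gaussFT
    linear_combination (-1/2 : ℂ) * key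
  · intro ξ
    have h1 : HasDerivAt (fun ξ : ℝ => cexp (I * ((x * ξ : ℝ) : ℂ)))
        (cexp (I * ((x * ξ : ℝ) : ℂ)) * (I * ((x * 1 : ℝ) : ℂ))) ξ :=
      ((((hasDerivAt_id ξ).const_mul x).ofReal_comp).const_mul I).cexp
    have h2 : HasDerivAt (fun ξ : ℝ => ((r.eval ξ * Real.exp (-1 * ξ ^ 2) : ℝ)))
        ((derivative r).eval ξ * Real.exp (-1 * ξ ^ 2) +
          r.eval ξ * (Real.exp (-1 * ξ ^ 2) * (-1 * (2 * ξ)))) ξ := by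
      refine (r.hasDerivAt ξ).mul (HasDerivAt.exp ?_)
      simpa using (hasDerivAt_pow 2 ξ).const_mul (-1 : ℝ)
    refine (h1.mul h2.ofReal_comp).congr_deriv ?_
    push_cast [Polynomial.eval_mul, Polynomial.eval_X]; ring
  · exact (((gaussFT_integrable r x).const_mul _).add (gaussFT_integrable _ x)).sub
      ((gaussFT_integrable _ x).const_mul _)

lemma gaussFT_one (x : ℝ) :
    gaussFT 1 x = (π : ℂ) ^ (1 / 2 : ℂ) * ((Real.exp (-(1 / 4) * x ^ 2) : ℝ) : ℂ) := by
  have := fourierIntegral_gaussian (b := 1) (by simp) (x : ℂ)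
  unfold gaussFT
  convert this using 2
  · ext ξ; push_cast [Polynomial.eval_one]; simp only [one_mul, mul_assoc]
  · simp
  · push_cast; ring_nf

open Polynomial in
lemma gaussFT_exists (r : ℝ[X]) : ∃ P : ℂ[X], ∀ x : ℝ,
    gaussFT r x = P.eval (x : ℂ) * ((Real.exp (-(1 / 4) * x ^ 2) : ℝ) : ℂ) := by
  have mono : ∀ n : ℕ, ∃ P : ℂ[X], ∀ x : ℝ,
      gaussFT (X ^ n) x = P.eval (x : ℂ) * ((Real.exp (-(1 / 4) * x ^ 2) : ℝ) : ℂ) := by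
    intro n
    induction n using Nat.strong_induction_on with
    | _ n ih =>
      rcases n with _ | n
      · exact ⟨C ((π : ℂ) ^ (1 / 2 : ℂ)), fun x => by simpa using gaussFT_one x⟩
      obtain ⟨P, hP⟩ := ih n (by omega)
      obtain ⟨Q, hQ⟩ := ih (n - 1) (by omega)
      refine ⟨C (1 / 2) * (C I * X * P + C (n : ℂ) * Q), fun x => ?_⟩
      rw [pow_succ', gaussFT_X_mul, hP, derivative_X_pow, gaussFT_smul, hQ]
      simp only [eval_mul, eval_add, eval_C, eval_X]
      push_cast; ring
  induction r using Polynomial.induction_on' with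
  | add p q hp hq =>
    obtain ⟨P, hP⟩ := hp
    obtain ⟨Q, hQ⟩ := hq
    exact ⟨P + Q, fun x => by rw [gaussFT_add, hP, hQ, eval_add]; ring⟩
  | monomial n a =>
    obtain ⟨P, hP⟩ := mono n
    refine ⟨C (a : ℂ) * P, fun x => ?_⟩
    rw [← C_mul_X_pow_eq_monomial, gaussFT_smul, hP, eval_mul, eval_C]; ring

/-- Physicists' Hermite polynomials. -/
noncomputable def Hp : ℕ → Polynomial ℝ
  | 0 => 1
  | k + 1 => 2 * Polynomial.X * Hp k - Polynomial.derivative (Hp k)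

open Polynomial in
lemma Hp_derivative (k : ℕ) : derivative (Hp (k + 1)) = C (2 * ((k : ℝ) + 1)) * Hp k := by
  induction k with
  | zero => simp [Hp]; exact (map_ofNat C 2).symm
  | succ k ih =>
    rw [Hp, derivative_sub, ih]
    simp only [derivative_mul, derivative_X, derivative_C, derivative_ofNat, ih]
    have h : Hp (k + 1) = 2 * X * Hp k - derivative (Hp k) := rfl
    simp only [map_mul, map_add, map_natCast, map_one, map_ofNat, Nat.cast_succ]
    linear_combination (- 2 * ((k : ℝ[X]) + 1)) * h

open Polynomial in
lemma Hp_rodrigues (k : ℕ) : iteratedDeriv k (fun t : ℝ => Real.exp (-t ^ 2)) =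
    fun x => (-1 : ℝ) ^ k * (Hp k).eval x * Real.exp (-x ^ 2) := by
  induction k with
  | zero => ext x; simp [Hp]
  | succ k ih =>
    rw [iteratedDeriv_succ, ih]
    ext x
    have h2 : HasDerivAt (fun ξ : ℝ => (((-1 : ℝ) ^ k * (Hp k).eval ξ * Real.exp (-ξ ^ 2) : ℝ)))
        ((-1 : ℝ) ^ k * (derivative (Hp k)).eval x * Real.exp (-x ^ 2) +
          (-1 : ℝ) ^ k * (Hp k).eval x * (Real.exp (-x ^ 2) * (-(2 * x)))) x := by
      refine (((Hp k).hasDerivAt x).const_mul _).mul (HasDerivAt.exp ?_)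
      simpa using (hasDerivAt_pow 2 x).fun_neg
    rw [h2.deriv, Hp]
    simp only [eval_sub, eval_mul, eval_X, eval_ofNat]
    ring

/-- Polynomial times `exp (-x²/2)`. -/
noncomputable def PG (p : Polynomial ℝ) (x : ℝ) : ℝ := p.eval x * Real.exp (-x ^ 2 / 2)

/-- normalization -/
noncomputable def hc (k : ℕ) : ℝ :=
  ((2 : ℝ) ^ k * Real.sqrt Real.pi * (k.factorial : ℝ)) ^ (-(1 / 2 : ℝ))

lemma hermiteFun_eq (k : ℕ) : hermiteFun k = PG (Polynomial.C (hc k) * Hp k) := by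
  ext x
  have e : Real.exp (x ^ 2) * Real.exp (-x ^ 2) = 1 := by rw [← Real.exp_add]; simp
  have s : ((-1 : ℝ) ^ k) * (-1) ^ k = 1 := by rw [← mul_pow]; simp
  rw [hermiteFun, hermitePoly, Hp_rodrigues, PG, Polynomial.eval_mul, Polynomial.eval_C, hc]
  linear_combination ((2 : ℝ) ^ k * Real.sqrt Real.pi * (k.factorial : ℝ)) ^ (-(1 / 2 : ℝ)) *
    (Hp k).eval x * Real.exp (-x ^ 2 / 2) * ((-1) ^ k * (-1) ^ k * e + s)

/-- gaussian integral of polynomial -/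
noncomputable def gI (p : Polynomial ℝ) : ℝ := ∫ x : ℝ, p.eval x * Real.exp (-1 * x ^ 2)

open Polynomial in
lemma gI_mul_Hp (p : ℝ[X]) (k : ℕ) : gI (p * Hp (k + 1)) = gI (derivative p * Hp k) := by
  have i (p : ℝ[X]) := integrable_poly_gauss p one_pos
  have key := integral_eq_zero_of_hasDerivAt_of_integrable
    (f := fun x : ℝ => (p * Hp k).eval x * Real.exp (-1 * x ^ 2))
    (f' := fun x : ℝ => (derivative p * Hp k).eval x * Real.exp (-1 * x ^ 2) -
      (p * Hp (k + 1)).eval x * Real.exp (-1 * x ^ 2)) ?_ ((i _).sub (i _)) (i _)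
  · rw [integral_sub (i _) (i _)] at key
    unfold gI; linarith
  · intro x
    have h2 := ((p * Hp k).hasDerivAt x).mul
      (d := fun ξ : ℝ => Real.exp (-1 * ξ ^ 2)) (HasDerivAt.exp (by
        simpa using (hasDerivAt_pow 2 x).const_mul (-1 : ℝ)))
    refine h2.congr_deriv ?_
    simp only [Hp, derivative_mul, eval_sub, eval_mul, eval_X, eval_ofNat, eval_add]
    ring

lemma gI_smul (a : ℝ) (p : Polynomial ℝ) : gI (Polynomial.C a * p) = a * gI p := by
  unfold gI
  rw [← integral_const_mul]
  congr 1; ext ξ; rw [Polynomial.eval_mul, Polynomial.eval_C]; ring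

lemma gI_Hp (m k : ℕ) : gI (Hp m * Hp k) =
    if m = k then (2 : ℝ) ^ k * Real.sqrt Real.pi * (k.factorial : ℝ) else 0 := by
  induction k generalizing m with
  | zero =>
    rcases m with _ | m
    · simpa [Hp, gI] using integral_gaussian 1
    · rw [mul_comm, gI_mul_Hp]; simp [Hp, gI]
  | succ k ih =>
    rw [gI_mul_Hp]
    rcases m with _ | m
    · simp [Hp, gI]
    · rw [Hp_derivative, mul_assoc, gI_smul, ih]
      by_cases h : m = k
      · subst h; simp [Nat.factorial_succ]; ring
      · simp [h]

lemma hermite_orthonormal (m k : ℕ) :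
    ∫ x : ℝ, hermiteFun m x * hermiteFun k x = if m = k then 1 else 0 := by
  have h : ∫ x : ℝ, hermiteFun m x * hermiteFun k x = hc m * (hc k * gI (Hp m * Hp k)) := by
    rw [← gI_smul, ← gI_smul, gI]
    congr 1; ext x
    have : Real.exp (-1 * x ^ 2) = Real.exp (-x ^ 2 / 2) * Real.exp (-x ^ 2 / 2) := by
      rw [← Real.exp_add]; ring_nf
    rw [hermiteFun_eq, hermiteFun_eq, PG, PG, this]
    simp only [Polynomial.eval_mul, Polynomial.eval_C]; ring
  rw [h, gI_Hp]
  by_cases e : m = k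
  · subst e
    have hp : 0 < (2 : ℝ) ^ m * Real.sqrt Real.pi * (m.factorial : ℝ) := by positivity
    simp only [if_true, hc]
    generalize (2 : ℝ) ^ m * Real.sqrt Real.pi * (m.factorial : ℝ) = A at hp
    rw [← mul_assoc, ← Real.rpow_add hp]
    norm_num [Real.rpow_neg_one, hp.ne']
  · simp [e]

/-- Unnormalized one-dimensional Fourier–Wigner transform. -/
noncomputable def VV (p q : Polynomial ℝ) (x y : ℝ) : ℂ :=
  ∫ ξ : ℝ, cexp (I * ((x * ξ : ℝ) : ℂ)) * ((PG p (ξ + y / 2) * PG q (ξ - y / 2) : ℝ) : ℂ)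

lemma PG_continuous (p : Polynomial ℝ) : Continuous (PG p) := by
  unfold PG
  exact p.continuous.mul (by fun_prop)

lemma PG_sq_integrable (p q : Polynomial ℝ) : Integrable fun x => PG p x * PG q x := by
  refine (integrable_poly_gauss (p * q) one_pos).congr (Filter.Eventually.of_forall fun x => ?_)
  have : Real.exp (-1 * x ^ 2) = Real.exp (-x ^ 2 / 2) * Real.exp (-x ^ 2 / 2) := by
    rw [← Real.exp_add]; ring_nf
  simp only [PG, this, Polynomial.eval_mul]; ring

lemma PG_bound (p q : Polynomial ℝ) (s t : ℝ) :
    ‖PG p s * PG q t‖ ≤ (PG p s * PG p s + PG q t * PG q t) / 2 := by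
  rw [Real.norm_eq_abs, abs_le]
  constructor <;> nlinarith [sq_nonneg (PG p s + PG q t), sq_nonneg (PG p s - PG q t)]

lemma PG_shift_integrable (p q : Polynomial ℝ) (a b : ℝ) :
    Integrable fun x => PG p (x + a) * PG q (x + b) := by
  have h := (((PG_sq_integrable p p).comp_add_right a).add
    ((PG_sq_integrable q q).comp_add_right b)).div_const 2
  refine h.mono' ?_ (Filter.Eventually.of_forall fun x => PG_bound p q _ _)
  exact (((PG_continuous p).comp (by fun_prop)).mul
    ((PG_continuous q).comp (by fun_prop))).aestronglyMeasurable

lemma VV_bdd (p q : Polynomial ℝ) : ∃ C, ∀ x y, ‖VV p q x y‖ ≤ C := by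
  refine ⟨∫ x, (PG p x * PG p x) / 2 + (PG q x * PG q x) / 2, fun x y => ?_⟩
  have i1 := ((PG_sq_integrable p p).div_const 2)
  have i2 := ((PG_sq_integrable q q).div_const 2)
  rw [integral_add i1 i2, ← integral_add_right_eq_self (fun x => PG p x * PG p x / 2) (y / 2),
    ← integral_sub_right_eq_self (fun x => PG q x * PG q x / 2) (y / 2),
    ← integral_add (i1.comp_add_right (y / 2)) (i2.comp_sub_right (y / 2))]
  refine norm_integral_le_of_norm_le ((i1.comp_add_right (y / 2)).add (i2.comp_sub_right (y / 2)))
    (Filter.Eventually.of_forall fun ξ => ?_)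
  rw [norm_mul, norm_phase, one_mul, Complex.norm_real]
  refine (PG_bound p q _ _).trans (le_of_eq ?_)
  ring

open Polynomial in
lemma biv_exists (p q : ℝ[X]) : ∃ (N : ℕ) (r : ℕ → ℝ[X]), ∀ ξ y : ℝ,
    p.eval (ξ + y / 2) * q.eval (ξ - y / 2) = ∑ i ∈ Finset.range N, (r i).eval ξ * y ^ i := by
  let A : ℝ[X][X] := C X + X * C (C (1 / 2))
  let B : ℝ[X][X] := C X - X * C (C (1 / 2))
  let R : ℝ[X][X] := (p.map (C.comp C)).eval A * (q.map (C.comp C)).eval B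
  have hev (p : ℝ[X]) (A : ℝ[X][X]) (ξ y : ℝ) :
      (((p.map (C.comp C)).eval A).eval (C y)).eval ξ = p.eval ((A.eval (C y)).eval ξ) := by
    induction p using Polynomial.induction_on' with
    | add p q hp hq => simp [hp, hq]
    | monomial n a => simp
  refine ⟨R.natDegree + 1, R.coeff, fun ξ y => ?_⟩
  have h1 : (R.eval (C y)).eval ξ = p.eval (ξ + y / 2) * q.eval (ξ - y / 2) := by
    simp only [R, eval_mul, hev]
    simp only [A, B, eval_add, eval_sub, eval_mul, eval_C, eval_X]
    ring_nf
  rw [← h1, eval_eq_sum_range (p := R), eval_finsetSum]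
  simp

open Polynomial in
lemma VV_rep (p q : ℝ[X]) : ∃ (N : ℕ) (P : ℕ → ℂ[X]), ∀ x y : ℝ,
    VV p q x y = ∑ i ∈ Finset.range N,
      ((P i).eval (x : ℂ) * ((Real.exp (-(1 / 4) * x ^ 2) : ℝ) : ℂ)) *
      ((((X : ℂ[X]) ^ i).eval (y : ℂ)) * ((Real.exp (-(1 / 4) * y ^ 2) : ℝ) : ℂ)) := by
  obtain ⟨N, r, hr⟩ := biv_exists p q
  choose P hP using fun i => gaussFT_exists (r i)
  refine ⟨N, P, fun x y => ?_⟩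
  simp_rw [← hP]
  unfold VV gaussFT
  simp_rw [← integral_mul_const]
  rw [← integral_finsetSum _ (fun i _ => (gaussFT_integrable (r i) x).mul_const _)]
  congr 1; ext ξ
  have e : PG p (ξ + y / 2) * PG q (ξ - y / 2) =
      (∑ i ∈ Finset.range N, (r i).eval ξ * y ^ i) * (Real.exp (-1 * ξ ^ 2) *
        Real.exp (-(1 / 4) * y ^ 2)) := by
    have : Real.exp (-1 * ξ ^ 2) * Real.exp (-(1 / 4) * y ^ 2) =
        Real.exp (-(ξ + y / 2) ^ 2 / 2) * Real.exp (-(ξ - y / 2) ^ 2 / 2) := by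
      rw [← Real.exp_add, ← Real.exp_add]; ring_nf
    rw [← hr, this, PG, PG]; ring
  rw [e, Finset.sum_mul, Complex.ofReal_sum, Finset.mul_sum]
  refine Finset.sum_congr rfl fun i _ => ?_
  simp only [eval_pow, eval_X, Complex.ofReal_mul, Complex.ofReal_pow]
  ring

lemma VV_continuous (p q : Polynomial ℝ) : Continuous fun a : ℝ × ℝ => VV p q a.1 a.2 := by
  obtain ⟨N, P, h⟩ := VV_rep p q
  simp_rw [h]
  refine continuous_finsetSum _ fun i _ => ?_
  refine Continuous.mul (Continuous.mul ?_ (by fun_prop)) (Continuous.mul ?_ (by fun_prop))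
  · exact (P i).continuous.comp (by fun_prop)
  · exact (Polynomial.X ^ i : Polynomial ℂ).continuous.comp (by fun_prop)

lemma VV_integrable (p q : Polynomial ℝ) :
    Integrable (fun a : ℝ × ℝ => VV p q a.1 a.2) (volume.prod volume) := by
  obtain ⟨N, P, h⟩ := VV_rep p q
  simp_rw [h]
  refine integrable_finsetSum _ fun i _ => ?_
  exact (integrable_cpoly_gauss (P i) (by norm_num)).mul_prod
    (integrable_cpoly_gauss (Polynomial.X ^ i) (by norm_num))

lemma VV_integrable_left (p q : Polynomial ℝ) (y : ℝ) :
    Integrable (fun x : ℝ => VV p q x y) := by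
  obtain ⟨N, P, h⟩ := VV_rep p q
  simp_rw [h]
  refine integrable_finsetSum _ fun i _ => ?_
  exact (integrable_cpoly_gauss (P i) (by norm_num)).mul_const _

open FourierTransform in
lemma VV_inv (p q : Polynomial ℝ) (ξ y : ℝ) :
    ∫ u : ℝ, cexp (I * ((-(u * ξ) : ℝ) : ℂ)) * VV p q u y =
      2 * π * ((PG p (ξ + y / 2) * PG q (ξ - y / 2) : ℝ) : ℂ) := by
  set f : ℝ → ℂ := fun ξ => ((PG p (ξ + y / 2) * PG q (ξ - y / 2) : ℝ) : ℂ) with hf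
  have hinv (w : ℝ) : 𝓕⁻ f w = VV p q (2 * π * w) y := by
    rw [Real.fourierInv_eq', VV]
    congr 1; ext v
    simp only [hf, smul_eq_mul]
    congr 2
    simp only [RCLike.inner_apply, conj_trivial]
    push_cast; ring
  have hfc : Continuous f := by
    have h1 := (PG_continuous p).comp (f := fun ξ : ℝ => ξ + y / 2) (by fun_prop)
    have h2 := (PG_continuous q).comp (f := fun ξ : ℝ => ξ - y / 2) (by fun_prop)
    exact Complex.continuous_ofReal.comp (h1.mul h2)
  have hfi : Integrable f := by
    have := PG_shift_integrable p q (y / 2) (-(y / 2))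
    exact this.ofReal
  have hFi : Integrable (𝓕 f) := by
    have : 𝓕 f = fun w => VV p q (-(2 * π) * w) y := by
      ext w
      have := Real.fourierInv_eq_fourier_neg f (-w)
      rw [neg_neg] at this
      rw [← this, hinv]; congr 1; ring
    rw [this]
    exact (VV_integrable_left p q y).comp_mul_left' (by simp [Real.pi_ne_zero])
  have key := congrFun (hfc.fourier_fourierInv_eq hfi hFi) ξ
  rw [Real.fourier_real_eq_integral_exp_smul] at key
  change _ = 2 * π * f ξ
  rw [← key]
  have hs := Measure.integral_comp_mul_left
    (fun u : ℝ => cexp (I * ((-(u * ξ) : ℝ) : ℂ)) * VV p q u y) (2 * π)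
  have h2 : (∫ v : ℝ, cexp (((-2 * π * v * ξ : ℝ) : ℂ) * I) • 𝓕⁻ f v) =
      ∫ v : ℝ, cexp (I * ((-(2 * π * v * ξ) : ℝ) : ℂ)) * VV p q (2 * π * v) y := by
    congr 1; ext v
    rw [hinv, smul_eq_mul]
    congr 2
    push_cast; ring
  rw [h2, hs, abs_of_pos (by positivity), Complex.real_smul, ← mul_assoc]
  have : (π : ℂ) ≠ 0 := by exact_mod_cast Real.pi_ne_zero
  have h3 : (2 * π : ℂ) * (((2 * π)⁻¹ : ℝ) : ℂ) = 1 := by push_cast; field_simp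
  rw [h3, one_mul]

lemma VV_slice (p q p' q' : Polynomial ℝ) (x y v : ℝ) :
    ∫ u : ℝ, cexp (I * (((y * u - x * v) / 2 : ℝ) : ℂ)) *
        (VV p q (x - u) (y - v) * VV p' q' u v) =
      2 * π * ∫ t : ℝ, (cexp (I * ((x * (t + y / 2) : ℝ) : ℂ)) *
        ((PG p (t + y) * PG q' t : ℝ) : ℂ)) * ((PG q (v + t) * PG p' (v + t) : ℝ) : ℂ) := by
  have hG : Integrable fun η : ℝ => ((PG p' (η + v / 2) * PG q' (η - v / 2) : ℝ) : ℂ) :=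
    (PG_shift_integrable p' q' (v / 2) (-(v / 2))).ofReal
  have hV : Integrable fun u : ℝ => VV p q (x - u) (y - v) :=
    (VV_integrable_left p q (y - v)).comp_sub_left x
  have hI := integrable_phase_mul (hV.mul_prod hG)
    (fun a : ℝ × ℝ => (y * a.1 - x * v) / 2 + a.1 * a.2) (by fun_prop)
  have e1 : (∫ u : ℝ, cexp (I * (((y * u - x * v) / 2 : ℝ) : ℂ)) *
        (VV p q (x - u) (y - v) * VV p' q' u v)) =
      ∫ u : ℝ, ∫ η : ℝ, cexp (I * ((((y * u - x * v) / 2 + u * η : ℝ)) : ℂ)) *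
        (VV p q (x - u) (y - v) * ((PG p' (η + v / 2) * PG q' (η - v / 2) : ℝ) : ℂ)) := by
    congr 1; ext u
    conv_lhs => rw [VV.eq_1 p' q', ← integral_const_mul, ← integral_const_mul]
    congr 1; ext η
    rw [Complex.ofReal_add, mul_add, Complex.exp_add]
    ring
  rw [e1, integral_integral_swap hI, ← integral_const_mul]
  symm
  rw [← integral_sub_right_eq_self _ (v / 2)]
  congr 1; ext η
  symm
  have e2 : (∫ u : ℝ, cexp (I * ((((y * u - x * v) / 2 + u * η : ℝ)) : ℂ)) *
        (VV p q (x - u) (y - v) * ((PG p' (η + v / 2) * PG q' (η - v / 2) : ℝ) : ℂ))) =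
      cexp (I * ((x * (η - v / 2 + y / 2) : ℝ) : ℂ)) *
        ((PG p' (η + v / 2) * PG q' (η - v / 2) : ℝ) : ℂ) *
      ∫ u : ℝ, cexp (I * ((-(u * (η + y / 2)) : ℝ) : ℂ)) * VV p q u (y - v) := by
    rw [← integral_const_mul, ← integral_sub_left_eq_self (fun u : ℝ => _ * (_ * VV p q u _)) _ x]
    congr 1; ext u
    have : cexp (I * ((((y * u - x * v) / 2 + u * η : ℝ)) : ℂ)) =
        cexp (I * ((x * (η - v / 2 + y / 2) : ℝ) : ℂ)) *
          cexp (I * ((-((x - u) * (η + y / 2)) : ℝ) : ℂ)) := by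
      rw [← Complex.exp_add]; congr 1; push_cast; ring
    rw [this]; ring
  rw [e2, VV_inv]
  have a1 : η + y / 2 + (y - v) / 2 = η - v / 2 + y := by ring
  have a2 : η + y / 2 - (y - v) / 2 = v + (η - v / 2) := by ring
  have a3 : η + v / 2 = v + (η - v / 2) := by ring
  rw [a1, a2, a3]
  push_cast; ring

lemma VV_twisted (p q p' q' : Polynomial ℝ) (x y : ℝ) :
    ∫ v : ℝ, ∫ u : ℝ, cexp (I * (((y * u - x * v) / 2 : ℝ) : ℂ)) *
        (VV p q (x - u) (y - v) * VV p' q' u v) =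
      2 * π * VV p q' x y * ((∫ s, PG q s * PG p' s : ℝ) : ℂ) := by
  simp_rw [VV_slice]
  rw [integral_const_mul]
  set A : ℝ → ℂ := fun t => cexp (I * ((x * (t + y / 2) : ℝ) : ℂ)) *
        ((PG p (t + y) * PG q' t : ℝ) : ℂ) with hA
  set B : ℝ → ℂ := fun s => ((PG q s * PG p' s : ℝ) : ℂ) with hB
  have iA : Integrable A := by
    have := PG_shift_integrable p q' y 0
    simp only [add_zero] at this
    exact integrable_phase_mul this.ofReal (fun t => x * (t + y / 2)) (by fun_prop)
  have iB : Integrable B := (PG_sq_integrable q p').ofReal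
  have iAB : Integrable (fun a : ℝ × ℝ => A a.2 * B (a.1 + a.2)) (volume.prod volume) := by
    have h := (measurePreserving_add_prod (volume : Measure ℝ) (volume : Measure ℝ)).integrable_comp
      (iB.mul_prod iA).aestronglyMeasurable
    refine (h.mpr (iB.mul_prod iA)).congr (Filter.Eventually.of_forall fun a => ?_)
    simp [mul_comm]
  have h1 : (∫ v : ℝ, ∫ t : ℝ, A t * B (v + t)) = (∫ t, A t) * ∫ s, B s := by
    rw [integral_integral_swap iAB]
    simp_rw [integral_const_mul, integral_add_right_eq_self B]
    rw [integral_mul_const]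
  have h2 : (∫ t, A t) = VV p q' x y := by
    rw [VV, ← integral_sub_right_eq_self A (y / 2)]
    congr 1; ext t
    simp only [hA]
    congr 3 <;> ring_nf
  have h3 : (∫ s, B s) = ((∫ s, PG q s * PG p' s : ℝ) : ℂ) := integral_ofReal
  change 2 * (π : ℂ) * (∫ v : ℝ, ∫ t : ℝ, A t * B (v + t)) = _
  rw [h1, h2, h3]; ring

/-- One-dimensional unnormalized special Hermite function. -/
noncomputable def S1 (k l : ℕ) (z : ℂ) : ℂ :=
  ∫ ξ : ℝ, cexp (I * ((z.re * ξ : ℝ) : ℂ)) * ((hermiteFun k (ξ + z.im / 2) : ℝ) : ℂ) *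
    ((hermiteFun l (ξ - z.im / 2) : ℝ) : ℂ)

lemma S1_eq (k l : ℕ) (z : ℂ) : S1 k l z =
    VV (Polynomial.C (hc k) * Hp k) (Polynomial.C (hc l) * Hp l) z.re z.im := by
  simp only [S1, VV, hermiteFun_eq, Complex.ofReal_mul, mul_assoc]

lemma S1_twisted (m l a b : ℕ) (z : ℂ) :
    ∫ w : ℂ, S1 m l (z - w) * S1 a b w *
      cexp (I / 2 * (((z * (starRingEnd ℂ) w).im : ℝ) : ℂ)) =
    2 * π * S1 m b z * (if l = a then 1 else 0) := by
  rw [← (Complex.volume_preserving_equiv_real_prod.symm).integral_comp'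
    (g := fun w : ℂ => S1 m l (z - w) * S1 a b w *
      cexp (I / 2 * (((z * (starRingEnd ℂ) w).im : ℝ) : ℂ)))]
  have orth := hermite_orthonormal l a
  rw [hermiteFun_eq, hermiteFun_eq] at orth
  simp only [S1_eq, Complex.measurableEquivRealProd_symm_apply, Complex.sub_re, Complex.sub_im]
  generalize Polynomial.C (hc m) * Hp m = p at *
  generalize Polynomial.C (hc l) * Hp l = q at *
  generalize Polynomial.C (hc a) * Hp a = p' at *
  generalize Polynomial.C (hc b) * Hp b = q' at *
  have key := VV_twisted p q p' q' z.re z.im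
  rw [orth] at key
  have e (a : ℝ × ℝ) : VV p q (z.re - a.1) (z.im - a.2) * VV p' q' a.1 a.2 *
      cexp (I / 2 * (((z * (starRingEnd ℂ) (⟨a.1, a.2⟩ : ℂ)).im : ℝ) : ℂ)) =
      cexp (I * (((z.im * a.1 - z.re * a.2) / 2 : ℝ) : ℂ)) *
        (VV p q (z.re - a.1) (z.im - a.2) * VV p' q' a.1 a.2) := by
    rw [mul_comm]
    congr 2
    simp only [Complex.mul_im, Complex.conj_re, Complex.conj_im]
    push_cast; ring
  simp_rw [e]
  rw [Measure.volume_eq_prod, integral_prod_symm]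
  · rw [key]; split_ifs <;> simp
  · refine integrable_phase_mul ?_ (fun a : ℝ × ℝ => (z.im * a.1 - z.re * a.2) / 2) (by fun_prop)
    obtain ⟨C, hC⟩ := VV_bdd p q
    refine (VV_integrable p' q').bdd_mul (c := C) ?_ (Filter.Eventually.of_forall fun a => hC _ _)
    exact ((VV_continuous p q).comp
      (f := fun a : ℝ × ℝ => (z.re - a.1, z.im - a.2)) (by fun_prop)).aestronglyMeasurable

lemma specialHermite_eq (n : ℕ) (μ ν : Fin n → ℕ) (z : Fin n → ℂ) :
    specialHermite n μ ν z = (((2 * Real.pi) ^ (-(n : ℝ) / 2) : ℝ) : ℂ) *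
      ∏ j, S1 (μ j) (ν j) (z j) := by
  unfold specialHermite S1
  rw [← integral_fintype_prod_volume_eq_prod]
  congr 2; ext ξ
  rw [Finset.prod_mul_distrib, Finset.prod_mul_distrib, ← Complex.exp_sum, ← Finset.mul_sum]
  push_cast; rfl

/-- Orthogonality of the special Hermite functions under twisted convolution:
`Φ_{μ,ν} × Φ_{α,β} = (2π)^{n/2} Φ_{μ,β}` if `ν = α`, and `= 0` otherwise. -/
theorem specialHermite_twistedConv_orthogonality (n : ℕ) (μ ν α β : Fin n → ℕ)
    (z : Fin n → ℂ) :
    twistedConv (specialHermite n μ ν) (specialHermite n α β) z =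
      if ν = α then (((2 * Real.pi) ^ ((n : ℝ) / 2) : ℝ) : ℂ) * specialHermite n μ β z
      else 0 := by
  have hpos : (0 : ℝ) < 2 * Real.pi := by positivity
  set c : ℝ := (2 * Real.pi) ^ (-(n : ℝ) / 2) with hc
  have e (w : Fin n → ℂ) : specialHermite n μ ν (z - w) * specialHermite n α β w *
      Complex.exp (Complex.I / 2 * (((∑ j, z j * (starRingEnd ℂ) (w j)).im : ℝ) : ℂ)) =
      ((c : ℂ) * c) * ∏ j, (S1 (μ j) (ν j) (z j - w j) * S1 (α j) (β j) (w j) *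
        cexp (I / 2 * (((z j * (starRingEnd ℂ) (w j)).im : ℝ) : ℂ))) := by
    rw [specialHermite_eq, specialHermite_eq, Finset.prod_mul_distrib, Finset.prod_mul_distrib,
      ← Complex.exp_sum, ← Finset.mul_sum, Complex.im_sum, Complex.ofReal_sum]
    simp only [Pi.sub_apply, ← hc]
    ring
  unfold twistedConv
  simp_rw [e]
  rw [integral_const_mul, integral_fintype_prod_volume_eq_prod
    (fun j (w : ℂ) => S1 (μ j) (ν j) (z j - w) * S1 (α j) (β j) w *
        cexp (I / 2 * (((z j * (starRingEnd ℂ) w).im : ℝ) : ℂ)))]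
  simp_rw [S1_twisted]
  split_ifs with h
  · subst h
    have h1 : (c : ℂ) * c * (2 * π) ^ n = 1 := by
      have : c * c * (2 * π) ^ n = 1 := by
        rw [hc, ← Real.rpow_natCast, ← Real.rpow_add hpos, ← Real.rpow_add hpos]
        ring_nf; simp
      exact_mod_cast this
    have h2 : (((2 * Real.pi) ^ ((n : ℝ) / 2) : ℝ) : ℂ) * c = 1 := by
      have : (2 * Real.pi) ^ ((n : ℝ) / 2) * c = 1 := by
        rw [hc, ← Real.rpow_add hpos]
        ring_nf; simp
      exact_mod_cast this
    rw [specialHermite_eq, ← hc, ← mul_assoc, h2]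
    simp only [if_true, mul_one, Finset.prod_mul_distrib, Finset.prod_const, Finset.card_univ,
      Fintype.card_fin]
    rw [← mul_assoc, ← mul_pow, h1]
  · obtain ⟨j, hj⟩ := Function.ne_iff.mp h
    rw [Finset.prod_eq_zero (Finset.mem_univ j) (by simp [hj]), mul_zero]
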